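/- Fix λ ∈ (0,1/2), a cutoff ζ, γ ∈ [0,1), K satisfying the standing assumptions, ρ ∈ (γ,1), β = 1/(ρ−γ). Suppose h₀ ∈ 𝒳_ρ satisfies ∫_{[0,R]} dh₀ ≤ R^{1−ρ} for all R > 0, and let h(·,t) = S_λ(t)h₀, i.e. h(x,t) = H(x e^{βt},t) with H the global mild solution of the regularized problem. Then ∫_{[0,R]} h(x,t) dx ≤ R^{1−ρ} for all R > 0 and all t ≥ 0. -/

import Mathlib

open MeasureTheory Real Set Filter Topology

noncomputable section

namespace Smol

/-- Standing assumptions on the coagulation kernel `K`: continuity on `(0,∞)²`, symmetry,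
nonnegativity, homogeneity of degree `γ` and the growth bound `K(x,y) ≤ C(x^γ + y^γ)`. -/
structure KernelHyp (K : ℝ → ℝ → ℝ) (γ C : ℝ) : Prop where
  cont : ContinuousOn (fun p : ℝ × ℝ => K p.1 p.2) (Ioi (0:ℝ) ×ˢ Ioi (0:ℝ))
  symm : ∀ x y : ℝ, 0 < x → 0 < y → K x y = K y x
  nonneg : ∀ x y : ℝ, 0 < x → 0 < y → 0 ≤ K x y
  homog : ∀ a x y : ℝ, 0 < a → 0 < x → 0 < y → K (a * x) (a * y) = a ^ γ * K x y
  growth : ∀ x y : ℝ, 0 < x → 0 < y → K x y ≤ C * (x ^ γ + y ^ γ)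

/-- A smooth monotone cutoff `ζ`, vanishing on `[0,1/2]` and equal to `1` on `[1,∞)`. -/
structure CutoffHyp (ζ : ℝ → ℝ) : Prop where
  smooth : ContDiffOn ℝ (⊤ : ℕ∞) ζ (Ici (0:ℝ))
  mono : MonotoneOn ζ (Ici (0:ℝ))
  zero : ∀ s : ℝ, s ≤ 1/2 → ζ s = 0
  one : ∀ s : ℝ, 1 ≤ s → ζ s = 1

/-- The regularized kernel `K_λ`. -/
def Kreg (K : ℝ → ℝ → ℝ) (ζ : ℝ → ℝ) (lam : ℝ) (y z : ℝ) : ℝ :=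
  K y z * ζ (y / lam) * ζ (z / lam) * ζ (y / (lam * (y + z))) * ζ (z / (lam * (y + z)))

/-- Membership in the space `𝒳_ρ` of nonnegative Radon measures on `[0,∞)` with
`sup_{R>0} (∫_{[0,R]} dh)/R^{1-ρ} < ∞`. -/
def MemX (ρ : ℝ) (μ : Measure ℝ) : Prop :=
  μ (Iio 0) = 0 ∧ ∃ M : ℝ, ∀ R > (0:ℝ), μ (Icc 0 R) ≤ ENNReal.ofReal (M * R ^ (1 - ρ))

/-- The norm `‖h‖_{𝒳_ρ} = sup_{R>0} (∫_{[0,R]} dh)/R^{1-ρ}`, expressed as the least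
admissible constant. -/
def Xnorm (ρ : ℝ) (μ : Measure ℝ) : ℝ :=
  sInf {M : ℝ | 0 ≤ M ∧ ∀ R > (0:ℝ), μ (Icc 0 R) ≤ ENNReal.ofReal (M * R ^ (1 - ρ))}

/-- The operator `𝒜[H](X,t) = ∫_0^∞ K_λ(Xe^{-βt},Ze^{-βt})/Z dH(Z,t) - βρ`. -/
def Acal (Kl : ℝ → ℝ → ℝ) (β ρ : ℝ) (H : ℝ → Measure ℝ) (X t : ℝ) : ℝ :=
  (∫ Z, Kl (X * exp (-(β * t))) (Z * exp (-(β * t))) / Z ∂(H t)) - β * ρ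

/-- The measure `𝒬[H](·,t)`, i.e. the weighted convolution
`𝒬[H](X,t) = ∫_0^X (K_λ(Ye^{-βt},(X-Y)e^{-βt})/(X-Y)) H(X-Y,t) dH(Y,t)`. -/
def Qcal (Kl : ℝ → ℝ → ℝ) (β : ℝ) (H : ℝ → Measure ℝ) (t : ℝ) : Measure ℝ :=
  Measure.map (fun p : ℝ × ℝ => p.1 + p.2)
    (((H t).prod (H t)).withDensity fun p =>
      ENNReal.ofReal (Kl (p.1 * exp (-(β * t))) (p.2 * exp (-(β * t))) / p.2))

/-- Mild solution on `[0,T]` of the regularized problem, in the sense of measures: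
`H(·,t) = h₀ e^{-∫_0^t 𝒜[H] ds} + ∫_0^t e^{-∫_s^t 𝒜[H] dξ} 𝒬[H](·,s) ds`,
together with membership in `C([0,T];𝒳_ρ)` (weak continuity in time). -/
def IsMildSolution (Kl : ℝ → ℝ → ℝ) (β ρ T : ℝ) (h0 : Measure ℝ)
    (H : ℝ → Measure ℝ) : Prop :=
  (∀ t ∈ Icc (0:ℝ) T, MemX ρ (H t)) ∧
  (∀ φ : ℝ → ℝ, Continuous φ → HasCompactSupport φ →
      ContinuousOn (fun t => ∫ X, φ X ∂(H t)) (Icc (0:ℝ) T)) ∧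
  (∀ t ∈ Icc (0:ℝ) T, ∀ φ : ℝ → ℝ, Continuous φ → HasCompactSupport φ →
      ∫ X, φ X ∂(H t)
        = (∫ X, φ X * exp (-(∫ s in (0:ℝ)..t, Acal Kl β ρ H X s)) ∂h0)
          + ∫ s in (0:ℝ)..t,
              ∫ X, φ X * exp (-(∫ ξ in s..t, Acal Kl β ρ H X ξ)) ∂(Qcal Kl β H s))

/-- The change of variables producing `h(·,t)` from `H(·,t)`:
`h(x,t) = H(xe^{βt},t)` as densities, i.e. `h(·,t) = e^{-βt}·(X ↦ Xe^{-βt})_*H(·,t)`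
as measures; `S_λ(t)h₀` is `Smap β t (H t)` for the mild solution `H` with datum `h₀`. -/
def Smap (β t : ℝ) (ν : Measure ℝ) : Measure ℝ :=
  ENNReal.ofReal (exp (-(β * t))) • Measure.map (fun X => X * exp (-(β * t))) ν

/-- The piecewise linear cutoff equal to `1` on `[-R, R]` and to `0` outside `[-(R+ε), R+ε]`. -/
def plateau (R ε x : ℝ) : ℝ := max 0 (min 1 ((R + ε - |x|) / ε))

lemma continuous_plateau (R ε : ℝ) : Continuous (plateau R ε) := by
  unfold plateau; fun_prop

lemma plateau_nonneg (R ε x : ℝ) : 0 ≤ plateau R ε x := le_max_left _ _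

lemma plateau_le_one (R ε x : ℝ) : plateau R ε x ≤ 1 :=
  max_le zero_le_one (min_le_left _ _)

lemma plateau_eq_one {R ε x : ℝ} (hε : 0 < ε) (hx : |x| ≤ R) : plateau R ε x = 1 := by
  have : 1 ≤ (R + ε - |x|) / ε := by rw [le_div_iff₀ hε]; linarith
  simp [plateau, this]

lemma plateau_eq_zero {R ε x : ℝ} (hε : 0 < ε) (hx : R + ε ≤ |x|) : plateau R ε x = 0 := by
  have : (R + ε - |x|) / ε ≤ 0 := div_nonpos_of_nonpos_of_nonneg (by linarith) hε.le
  simp [plateau, this]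

lemma plateau_antitoneOn {R ε x y : ℝ} (hε : 0 < ε) (hx : 0 ≤ x) (hxy : x ≤ y) :
    plateau R ε y ≤ plateau R ε x := by
  unfold plateau
  rw [abs_of_nonneg hx, abs_of_nonneg (hx.trans hxy)]
  gcongr

lemma hasCompactSupport_plateau {R ε : ℝ} (hε : 0 < ε) : HasCompactSupport (plateau R ε) :=
  HasCompactSupport.intro (isCompact_Icc (a := -(R + ε)) (b := R + ε)) fun x hx =>
    plateau_eq_zero hε <| by
      by_contra! h
      exact hx (abs_le.1 h.le)

/-- A vaguely continuous family of locally finite measures on the line. -/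
structure VagueCurve (ν : ℝ → Measure ℝ) : Prop where
  locFin : ∀ s, IsLocallyFiniteMeasure (ν s)
  cont : ∀ φ : ℝ → ℝ, Continuous φ → HasCompactSupport φ → Continuous fun s => ∫ X, φ X ∂(ν s)

lemma hasCompactSupport_of_abs {f : ℝ → ℝ} {R : ℝ} (h : ∀ Z, R < |Z| → f Z = 0) :
    HasCompactSupport f :=
  HasCompactSupport.intro (isCompact_Icc (a := -R) (b := R)) fun x hx => h x <| by
    by_contra! h'
    exact hx (abs_le.1 h')

/-- Integrals of a jointly continuous integrand, with locally uniformly bounded support, against a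
vaguely continuous family of measures depend continuously on the parameter. -/
lemma VagueCurve.continuous_integral {ν : ℝ → Measure ℝ} (hν : VagueCurve ν)
    {P : Type*} [TopologicalSpace P] {f : P → ℝ → ℝ} {σ : P → ℝ}
    (hf : Continuous fun q : P × ℝ => f q.1 q.2) (hσ : Continuous σ)
    (hsupp : ∀ p₀, ∃ R : ℝ, ∀ᶠ p in 𝓝 p₀, ∀ Z, R < |Z| → f p Z = 0) :
    Continuous fun p => ∫ Z, f p Z ∂(ν (σ p)) := by
  have := hν.locFin
  rw [continuous_iff_continuousAt]
  intro p₀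
  obtain ⟨R, hR⟩ := hsupp p₀
  have hcf : ∀ p, Continuous (f p) := fun p => hf.comp (by fun_prop : Continuous fun Z => (p, Z))
  have hint : ∀ p, (∀ Z, R < |Z| → f p Z = 0) → ∀ s, Integrable (f p) (ν s) := fun p hp s =>
    (hcf p).integrable_of_hasCompactSupport (hasCompactSupport_of_abs hp)
  set χ := plateau R 1
  have hχc : Continuous χ := continuous_plateau R 1
  have hχs : HasCompactSupport χ := hasCompactSupport_plateau one_pos
  have hχi : ∀ s, Integrable χ (ν s) := fun s => hχc.integrable_of_hasCompactSupport hχs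
  have hm : Continuous fun p => ∫ Z, χ Z ∂(ν (σ p)) := (hν.cont χ hχc hχs).comp hσ
  set M : ℝ := ∫ Z, χ Z ∂(ν (σ p₀)) with hM
  have hM0 : 0 ≤ M := integral_nonneg fun Z => plateau_nonneg _ _ _
  have hR0 : ∀ Z, R < |Z| → f p₀ Z = 0 := hR.self_of_nhds
  have h0 : Continuous fun p => ∫ Z, f p₀ Z ∂(ν (σ p)) :=
    (hν.cont (f p₀) (hcf p₀) (hasCompactSupport_of_abs hR0)).comp hσ
  rw [ContinuousAt, Metric.tendsto_nhds]
  intro ε hε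
  set η := ε / (2 * (M + 1)) with hη
  have hη0 : 0 < η := by positivity
  have hunif : ∀ᶠ p in 𝓝 p₀, ∀ Z ∈ Icc (-R) R, |f p Z - f p₀ Z| < η := by
    refine isCompact_Icc.eventually_forall_of_forall_eventually fun Z _ => ?_
    have hc : Continuous fun q : P × ℝ => |f q.1 q.2 - f p₀ q.2| :=
      (hf.sub ((hcf p₀).comp continuous_snd)).abs
    exact (hc.tendsto (p₀, Z)).eventually_lt_const (by simpa using hη0)
  filter_upwards [hR, hunif, (hm.tendsto p₀).eventually_lt_const (lt_add_one M),
    (Metric.tendsto_nhds.1 (h0.tendsto p₀)) (ε / 2) (by positivity)] with p h1 h2 h3 h4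
  have hle : ∀ Z, |f p Z - f p₀ Z| ≤ η * χ Z := by
    intro Z
    rcases le_or_gt |Z| R with hZ | hZ
    · rw [show χ Z = 1 from plateau_eq_one one_pos hZ, mul_one]
      exact (h2 Z (abs_le.1 hZ)).le
    · rw [h1 Z hZ, hR0 Z hZ, sub_zero, abs_zero]
      exact mul_nonneg hη0.le (plateau_nonneg _ _ _)
  have h5 : |∫ Z, f p Z ∂(ν (σ p)) - ∫ Z, f p₀ Z ∂(ν (σ p))| ≤ η * ∫ Z, χ Z ∂(ν (σ p)) := by
    rw [← integral_sub (hint p h1 _) (hint p₀ hR0 _), ← integral_const_mul]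
    exact (abs_integral_le_integral_abs).trans
      (integral_mono ((hint p h1 _).sub (hint p₀ hR0 _)).abs ((hχi _).const_mul η) hle)
  have h6 : η * ∫ Z, χ Z ∂(ν (σ p)) ≤ ε / 2 := by
    calc η * ∫ Z, χ Z ∂(ν (σ p)) ≤ η * (M + 1) := by gcongr
      _ = ε / 2 := by rw [hη]; field_simp
  rw [Real.dist_eq] at h4 ⊢
  calc _ ≤ _ := abs_sub_le _ (∫ Z, f p₀ Z ∂(ν (σ p))) _
    _ < ε := by linarith

/-- A jointly continuous nonnegative rate `G t X Z` supported in `0 < Z ≤ c X`. -/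
structure AdmissibleRate (G : ℝ → ℝ → ℝ → ℝ) (c : ℝ) : Prop where
  cont : Continuous fun p : ℝ × ℝ × ℝ => G p.1 p.2.1 p.2.2
  nonneg : ∀ t X Z, 0 ≤ G t X Z
  supp : ∀ t X Z, G t X Z ≠ 0 → 0 < X ∧ 0 < Z ∧ Z ≤ c * X

/-- The coagulation rate `K(Xe^{-βt},Ze^{-βt})/Z` in the moving frame. -/
def rate (Kl : ℝ → ℝ → ℝ) (β t X Z : ℝ) : ℝ :=
  Kl (X * exp (-(β * t))) (Z * exp (-(β * t))) / Z

lemma CutoffHyp.nonneg {ζ : ℝ → ℝ} (hζ : CutoffHyp ζ) (s : ℝ) : 0 ≤ ζ s := by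
  rcases le_total s (1/2) with h | h
  · exact (hζ.zero s h).ge
  · rw [← hζ.zero 0 (by norm_num)]
    exact hζ.mono (by simp) (mem_Ici.2 (by linarith)) (by linarith)

lemma CutoffHyp.continuous {ζ : ℝ → ℝ} (hζ : CutoffHyp ζ) : Continuous ζ := by
  rw [continuous_iff_continuousAt]
  intro s
  rcases lt_or_ge s (1/2) with h | h
  · refine (continuousAt_const (y := (0:ℝ))).congr ?_
    filter_upwards [Iio_mem_nhds h] with x hx using (hζ.zero x (le_of_lt hx)).symm
  · exact hζ.smooth.continuousOn.continuousAt (Ici_mem_nhds (by linarith))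

section Regularized

variable {K : ℝ → ℝ → ℝ} {ζ : ℝ → ℝ} {γ C lam : ℝ}

lemma Kreg_eq_zero_of_le (hζ : CutoffHyp ζ) (hlam : 0 < lam) {y z : ℝ}
    (h : y ≤ lam / 2 ∨ z ≤ lam / 2) : Kreg K ζ lam y z = 0 := by
  rcases h with h | h
  · have : ζ (y / lam) = 0 := hζ.zero _ (by rw [div_le_iff₀ hlam]; linarith)
    simp [Kreg, this]
  · have : ζ (z / lam) = 0 := hζ.zero _ (by rw [div_le_iff₀ hlam]; linarith)
    simp [Kreg, this]

lemma Kreg_supp (hζ : CutoffHyp ζ) (hlam : 0 < lam) {y z : ℝ} (h : Kreg K ζ lam y z ≠ 0) :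
    lam / 2 < y ∧ lam / 2 < z ∧ z ≤ 2 / lam * y := by
  have hy : lam / 2 < y := by
    by_contra! h'
    exact h (Kreg_eq_zero_of_le hζ hlam (Or.inl h'))
  have hz : lam / 2 < z := by
    by_contra! h'
    exact h (Kreg_eq_zero_of_le hζ hlam (Or.inr h'))
  have hyz : 0 < y + z := by linarith
  refine ⟨hy, hz, ?_⟩
  by_contra! h'
  refine h ?_
  have : ζ (y / (lam * (y + z))) = 0 := by
    refine hζ.zero _ ?_
    rw [div_le_iff₀ (by positivity)]
    rw [div_mul_eq_mul_div, div_lt_iff₀ hlam] at h'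
    nlinarith
  simp [Kreg, this]

lemma Kreg_nonneg (hK : KernelHyp K γ C) (hζ : CutoffHyp ζ) (hlam : 0 < lam) (y z : ℝ) :
    0 ≤ Kreg K ζ lam y z := by
  by_cases h : Kreg K ζ lam y z = 0
  · exact h.ge
  · obtain ⟨hy, hz, -⟩ := Kreg_supp hζ hlam h
    have := hK.nonneg y z (by linarith) (by linarith)
    have hn := hζ.nonneg
    unfold Kreg
    have := hn (y / lam)
    have := hn (z / lam)
    have := hn (y / (lam * (y + z)))
    have := hn (z / (lam * (y + z)))
    positivity

lemma continuous_Kreg_div (hK : KernelHyp K γ C) (hζ : CutoffHyp ζ) (hlam : 0 < lam) :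
    Continuous fun p : ℝ × ℝ => Kreg K ζ lam p.1 p.2 / p.2 := by
  rw [continuous_iff_continuousAt]
  rintro ⟨y, z⟩
  by_cases h : y < lam / 2 ∨ z < lam / 2
  · refine (continuousAt_const (y := (0:ℝ))).congr ?_
    have ho : IsOpen {p : ℝ × ℝ | p.1 < lam / 2 ∨ p.2 < lam / 2} :=
      (isOpen_lt continuous_fst continuous_const).union
        (isOpen_lt continuous_snd continuous_const)
    filter_upwards [ho.mem_nhds h] with p hp
    rw [Kreg_eq_zero_of_le hζ hlam (hp.imp le_of_lt le_of_lt), zero_div]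
  · push Not at h
    have hy : 0 < y := by linarith [h.1]
    have hz : 0 < z := by linarith [h.2]
    have hK' : ContinuousAt (fun p : ℝ × ℝ => K p.1 p.2) (y, z) :=
      hK.cont.continuousAt (prod_mem_nhds (Ioi_mem_nhds hy) (Ioi_mem_nhds hz))
    have hζc := hζ.continuous
    have h1 : ContinuousAt (fun p : ℝ × ℝ => p.1 / (lam * (p.1 + p.2))) (y, z) :=
      ContinuousAt.div (by fun_prop) (by fun_prop) (by positivity)
    have h2 : ContinuousAt (fun p : ℝ × ℝ => p.2 / (lam * (p.1 + p.2))) (y, z) :=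
      ContinuousAt.div (by fun_prop) (by fun_prop) (by positivity)
    unfold Kreg
    refine ContinuousAt.div ?_ continuousAt_snd hz.ne'
    refine (((hK'.mul ?_).mul ?_).mul (hζc.continuousAt.comp h1)).mul (hζc.continuousAt.comp h2)
    · exact (hζc.comp (by fun_prop : Continuous fun p : ℝ × ℝ => p.1 / lam)).continuousAt
    · exact (hζc.comp (by fun_prop : Continuous fun p : ℝ × ℝ => p.2 / lam)).continuousAt

lemma admissibleRate_Kreg (hK : KernelHyp K γ C) (hζ : CutoffHyp ζ) (hlam : 0 < lam) (β : ℝ) :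
    AdmissibleRate (rate (Kreg K ζ lam) β) (2 / lam) := by
  have hsupp : ∀ t X Z, rate (Kreg K ζ lam) β t X Z ≠ 0 → 0 < X ∧ 0 < Z ∧ Z ≤ 2 / lam * X := by
    intro t X Z h
    have he := exp_pos (-(β * t))
    obtain ⟨h1, h2, h3⟩ := Kreg_supp hζ hlam (left_ne_zero_of_mul h)
    refine ⟨pos_of_mul_pos_left (by linarith) he.le, pos_of_mul_pos_left (by linarith) he.le, ?_⟩
    rw [← mul_assoc] at h3
    exact le_of_mul_le_mul_right h3 he
  refine ⟨?_, fun t X Z => ?_, hsupp⟩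
  · have h := (continuous_Kreg_div hK hζ hlam).comp
      (by fun_prop : Continuous fun p : ℝ × ℝ × ℝ =>
        (p.2.1 * exp (-(β * p.1)), p.2.2 * exp (-(β * p.1))))
    have h' := h.mul (by fun_prop : Continuous fun p : ℝ × ℝ × ℝ => exp (-(β * p.1)))
    refine h'.congr fun p => ?_
    have he := (exp_pos (-(β * p.1))).ne'
    change Kreg K ζ lam _ _ / (p.2.2 * exp (-(β * p.1))) * exp (-(β * p.1)) = _ / p.2.2
    rw [div_mul_eq_mul_div, mul_div_mul_right _ _ he]
  · by_cases h : rate (Kreg K ζ lam) β t X Z = 0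
    · exact h.ge
    · exact div_nonneg (Kreg_nonneg hK hζ hlam _ _) (hsupp t X Z h).2.1.le

end Regularized

/-- The loss coefficient `∫ G(t,X,Z) dν_t(Z)`. -/
def loss (G : ℝ → ℝ → ℝ → ℝ) (ν : ℝ → Measure ℝ) (X t : ℝ) : ℝ := ∫ Z, G t X Z ∂(ν t)

/-- The gain functional `∬ ψ(Y+Z) G(s,Y,Z) dν_s(Z) dν_s(Y)`. -/
def gain (G : ℝ → ℝ → ℝ → ℝ) (ν : ℝ → Measure ℝ) (ψ : ℝ → ℝ) (s : ℝ) : ℝ :=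
  ∫ Y, ∫ Z, ψ (Y + Z) * G s Y Z ∂(ν s) ∂(ν s)

section Evolution

variable {ν : ℝ → Measure ℝ} {G : ℝ → ℝ → ℝ → ℝ} {c : ℝ}

lemma AdmissibleRate.eq_zero_of_abs (hG : AdmissibleRate G c) {t X Z : ℝ}
    (h : |c| * |X| < |Z|) : G t X Z = 0 := by
  by_contra h'
  obtain ⟨-, hZ, hcX⟩ := hG.supp t X Z h'
  rw [← abs_mul, abs_of_pos hZ] at h
  exact absurd (hcX.trans (le_abs_self _)) (not_le.2 h)

lemma eventually_abs_bound {P : Type*} [TopologicalSpace P] {x : P → ℝ} (hx : Continuous x)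
    (c : ℝ) (p₀ : P) : ∃ R : ℝ, ∀ᶠ p in 𝓝 p₀, |c| * |x p| ≤ R := by
  refine ⟨|c| * (|x p₀| + 1), ?_⟩
  filter_upwards [(hx.abs.tendsto p₀).eventually_lt_const (lt_add_one _)] with p hp
  gcongr

lemma continuous_loss (hν : VagueCurve ν) (hG : AdmissibleRate G c) :
    Continuous fun q : ℝ × ℝ => loss G ν q.1 q.2 := by
  refine hν.continuous_integral (f := fun (q : ℝ × ℝ) Z => G q.2 q.1 Z)
    (hG.cont.comp (by fun_prop : Continuous fun q : (ℝ × ℝ) × ℝ => (q.1.2, q.1.1, q.2)))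
    continuous_snd fun p₀ => ?_
  obtain ⟨R, hR⟩ := eventually_abs_bound continuous_fst c p₀
  exact ⟨R, hR.mono fun p hp Z hZ => hG.eq_zero_of_abs (hp.trans_lt hZ)⟩

section Gain

variable {P : Type*} [TopologicalSpace P] {ψ : P → ℝ → ℝ} {σ : P → ℝ} {R : ℝ}

lemma continuous_gain_integrand (hG : AdmissibleRate G c)
    (hψ : Continuous fun q : P × ℝ => ψ q.1 q.2) (hσ : Continuous σ) :
    Continuous fun q : (P × ℝ) × ℝ => ψ q.1.1 (q.1.2 + q.2) * G (σ q.1.1) q.1.2 q.2 :=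
  (hψ.comp (by fun_prop : Continuous fun q : (P × ℝ) × ℝ => (q.1.1, q.1.2 + q.2))).mul
    (hG.cont.comp (by fun_prop : Continuous fun q : (P × ℝ) × ℝ => (σ q.1.1, q.1.2, q.2)))

lemma continuous_gain_inner (hν : VagueCurve ν) (hG : AdmissibleRate G c)
    (hψ : Continuous fun q : P × ℝ => ψ q.1 q.2) (hσ : Continuous σ) :
    Continuous fun q : P × ℝ => ∫ Z, ψ q.1 (q.2 + Z) * G (σ q.1) q.2 Z ∂(ν (σ q.1)) := by
  refine hν.continuous_integral (f := fun (q : P × ℝ) Z => ψ q.1 (q.2 + Z) * G (σ q.1) q.2 Z)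
    (continuous_gain_integrand hG hψ hσ) (hσ.comp continuous_fst) fun p₀ => ?_
  obtain ⟨R, hR⟩ := eventually_abs_bound (continuous_snd (X := P) (Y := ℝ)) c p₀
  exact ⟨R, hR.mono fun p hp Z hZ => by rw [hG.eq_zero_of_abs (hp.trans_lt hZ), mul_zero]⟩

lemma gain_integrand_eq_zero (hG : AdmissibleRate G c) {φ : ℝ → ℝ}
    (hR : ∀ X, R < |X| → φ X = 0) {s Y : ℝ} (hY : R < |Y|) (Z : ℝ) :
    φ (Y + Z) * G s Y Z = 0 := by
  by_cases h : G s Y Z = 0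
  · rw [h, mul_zero]
  · obtain ⟨h1, h2, -⟩ := hG.supp _ _ _ h
    rw [hR (Y + Z), zero_mul]
    rw [abs_of_pos h1] at hY
    rw [abs_of_pos (by linarith)]
    linarith

lemma continuous_gain (hν : VagueCurve ν) (hG : AdmissibleRate G c)
    (hψ : Continuous fun q : P × ℝ => ψ q.1 q.2) (hσ : Continuous σ)
    (hR : ∀ p X, R < |X| → ψ p X = 0) :
    Continuous fun p => gain G ν (ψ p) (σ p) := by
  refine hν.continuous_integral
    (f := fun p Y => ∫ Z, ψ p (Y + Z) * G (σ p) Y Z ∂(ν (σ p)))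
    (continuous_gain_inner hν hG hψ hσ) hσ fun p₀ => ⟨R, Eventually.of_forall fun p Y hY => ?_⟩
  simp [gain_integrand_eq_zero hG (hR p) hY]

end Gain

lemma integral_Qcal {Kl : ℝ → ℝ → ℝ} {β : ℝ} (hν : VagueCurve ν)
    (hG : AdmissibleRate (rate Kl β) c) {φ : ℝ → ℝ} (hφ : Continuous φ) {R : ℝ}
    (hR : ∀ X, R < |X| → φ X = 0) (s : ℝ) :
    ∫ X, φ X ∂(Qcal Kl β ν s) = gain (rate Kl β) ν φ s := by
  have := hν.locFin
  have hc2 : Continuous fun p : ℝ × ℝ => rate Kl β s p.1 p.2 :=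
    hG.cont.comp (by fun_prop : Continuous fun p : ℝ × ℝ => (s, p.1, p.2))
  have hprod : Continuous fun p : ℝ × ℝ => φ (p.1 + p.2) * rate Kl β s p.1 p.2 :=
    (hφ.comp (by fun_prop)).mul hc2
  have hcs : HasCompactSupport fun p : ℝ × ℝ => φ (p.1 + p.2) * rate Kl β s p.1 p.2 := by
    refine HasCompactSupport.intro (isCompact_Icc.prod isCompact_Icc :
      IsCompact (Icc (-R) R ×ˢ Icc (-(|c| * R)) (|c| * R))) fun p hp => ?_
    by_contra h
    refine hp (mem_prod.2 ?_)
    rw [mem_Icc, mem_Icc, ← abs_le, ← abs_le]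
    have h1 : |p.1| ≤ R := by
      by_contra! h1
      exact h (gain_integrand_eq_zero hG hR h1 _)
    refine ⟨h1, le_trans ?_ (mul_le_mul_of_nonneg_left h1 (abs_nonneg c))⟩
    by_contra! h2
    exact h (by rw [hG.eq_zero_of_abs h2, mul_zero])
  have hint := hprod.integrable_of_hasCompactSupport (μ := (ν s).prod (ν s)) hcs
  rw [Qcal, integral_map (by fun_prop) hφ.aestronglyMeasurable]
  change ∫ p : ℝ × ℝ, φ (p.1 + p.2) ∂(((ν s).prod (ν s)).withDensity fun p =>
    ENNReal.ofReal (rate Kl β s p.1 p.2)) = _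
  rw [integral_withDensity_eq_integral_toReal_smul
      (hc2.measurable.ennreal_ofReal : Measurable fun p : ℝ × ℝ =>
        ENNReal.ofReal (rate Kl β s p.1 p.2))
      (Eventually.of_forall fun _ => ENNReal.ofReal_lt_top), gain, ← integral_prod _ hint]
  refine integral_congr_ae (Eventually.of_forall fun p => ?_)
  simp only [smul_eq_mul]
  rw [mul_comm]
  congr 1
  exact ENNReal.toReal_ofReal (hG.nonneg _ _ _)

/-- Coagulation only moves mass to the right. -/
lemma gain_le_integral_loss (hν : VagueCurve ν) (hG : AdmissibleRate G c) {φ : ℝ → ℝ}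
    (hφ : Continuous φ) (hanti : AntitoneOn φ (Ici 0)) {R : ℝ}
    (hR : ∀ X, R < |X| → φ X = 0) (s : ℝ) :
    gain G ν φ s ≤ ∫ X, φ X * loss G ν X s ∂(ν s) := by
  have := hν.locFin
  have hlc : Continuous fun X => loss G ν X s :=
    (continuous_loss hν hG).comp (by fun_prop : Continuous fun X : ℝ => (X, s))
  have hGc : ∀ Y, Continuous fun Z => G s Y Z := fun Y =>
    hG.cont.comp (by fun_prop : Continuous fun Z : ℝ => (s, Y, Z))
  have hGi : ∀ Y, ∀ f : ℝ → ℝ, Continuous f → Integrable (fun Z => f Z * G s Y Z) (ν s) := by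
    intro Y f hf
    refine (hf.fun_mul (hGc Y)).integrable_of_hasCompactSupport
      (hasCompactSupport_of_abs (R := |c| * |Y|) fun Z hZ => ?_)
    rw [hG.eq_zero_of_abs hZ, mul_zero]
  refine integral_mono ?_ ?_ fun Y => ?_
  · refine Continuous.integrable_of_hasCompactSupport ?_
      (hasCompactSupport_of_abs (R := R) fun Y hY => ?_)
    · exact (continuous_gain_inner (P := Unit) (ψ := fun _ => φ) (σ := fun _ => s) hν hG
        (by fun_prop) continuous_const).comp (by fun_prop : Continuous fun Y : ℝ => ((), Y))
    · simp [gain_integrand_eq_zero hG hR hY]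
  · exact (hφ.fun_mul hlc).integrable_of_hasCompactSupport
      (hasCompactSupport_of_abs (R := R) fun X hX => by rw [hR X hX, zero_mul])
  · change _ ≤ φ Y * ∫ Z, G s Y Z ∂(ν s)
    rw [← integral_const_mul]
    refine integral_mono (hGi Y _ (by fun_prop)) (hGi Y _ continuous_const) fun Z => ?_
    change φ (Y + Z) * G s Y Z ≤ φ Y * G s Y Z
    by_cases h : G s Y Z = 0
    · simp [h]
    · obtain ⟨h1, h2, -⟩ := hG.supp _ _ _ h
      exact mul_le_mul_of_nonneg_right
        (hanti (mem_Ici.2 h1.le) (mem_Ici.2 (by linarith)) (by linarith)) (hG.nonneg _ _ _)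

end Evolution

section Exponential

variable {A : ℝ → ℝ → ℝ}

/-- The survival factor `exp (-∫_s^t A(X,ξ) dξ)`. -/
def survival (A : ℝ → ℝ → ℝ) (s t X : ℝ) : ℝ := exp (-(∫ ξ in s..t, A X ξ))

lemma intervalIntegrable_slice (hA : Continuous fun q : ℝ × ℝ => A q.1 q.2) (X s t : ℝ) :
    IntervalIntegrable (A X) volume s t :=
  (hA.comp (by fun_prop : Continuous fun ξ : ℝ => (X, ξ))).intervalIntegrable _ _

lemma survival_self (s X : ℝ) : survival A s s X = 1 := by simp [survival]

lemma survival_mul (hA : Continuous fun q : ℝ × ℝ => A q.1 q.2) (r s t X : ℝ) :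
    survival A s t X * survival A r s X = survival A r t X := by
  unfold survival
  rw [← exp_add, ← intervalIntegral.integral_add_adjacent_intervals
    (intervalIntegrable_slice hA X r s) (intervalIntegrable_slice hA X s t)]
  ring_nf

lemma continuous_survival (hA : Continuous fun q : ℝ × ℝ => A q.1 q.2) :
    Continuous fun q : ℝ × ℝ × ℝ => survival A q.1 q.2.1 q.2.2 := by
  have hu : Continuous (Function.uncurry fun (q : ℝ × ℝ × ℝ) ξ => A q.2.2 ξ) :=
    hA.comp (by fun_prop : Continuous fun q : (ℝ × ℝ × ℝ) × ℝ => (q.1.2.2, q.2))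
  have h1 := intervalIntegral.continuous_parametric_intervalIntegral_of_continuous
    (μ := volume) (a₀ := 0) hu (by fun_prop : Continuous fun q : ℝ × ℝ × ℝ => q.2.1)
  have h2 := intervalIntegral.continuous_parametric_intervalIntegral_of_continuous
    (μ := volume) (a₀ := 0) hu (by fun_prop : Continuous fun q : ℝ × ℝ × ℝ => q.1)
  refine continuous_exp.comp ((h1.fun_sub h2).fun_neg.congr fun q => ?_)
  rw [intervalIntegral.integral_interval_sub_left (intervalIntegrable_slice hA _ _ _)
    (intervalIntegrable_slice hA _ _ _)]

lemma one_sub_survival (hA : Continuous fun q : ℝ × ℝ => A q.1 q.2) (t δ X : ℝ) :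
    1 - survival A t (t + δ) X =
      δ * ∫ u in (0:ℝ)..1, A X (t + δ * u) * survival A t (t + δ * u) X := by
  have hAX : Continuous (A X) := hA.comp (by fun_prop : Continuous fun ξ : ℝ => (X, ξ))
  have hd : ∀ τ, HasDerivAt (fun τ => -survival A t τ X) (A X τ * survival A t τ X) τ := by
    intro τ
    have := (hAX.integral_hasStrictDerivAt t τ).hasDerivAt.neg.exp.neg
    refine this.congr_deriv ?_
    change -(survival A t τ X * -A X τ) = _
    ring
  have hs : Continuous fun τ => survival A t τ X :=
    (continuous_survival hA).comp (by fun_prop : Continuous fun τ : ℝ => (t, τ, X))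
  rw [intervalIntegral.mul_integral_comp_add_mul (f := fun τ => A X τ * survival A t τ X),
    intervalIntegral.integral_eq_sub_of_hasDerivAt (fun τ _ => hd τ)
      ((hAX.mul hs).intervalIntegrable _ _)]
  simp only [mul_zero, add_zero, mul_one, survival_self]
  ring

end Exponential

section Gronwall

variable {ν : ℝ → Measure ℝ} {G : ℝ → ℝ → ℝ → ℝ} {c b : ℝ} {h0 : Measure ℝ} {A : ℝ → ℝ → ℝ}

/-- The mild formulation, with the gain written as a functional on test functions. -/
def MildIdentity (G : ℝ → ℝ → ℝ → ℝ) (A : ℝ → ℝ → ℝ) (h0 : Measure ℝ) (ν : ℝ → Measure ℝ) : Prop :=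
  ∀ t : ℝ, 0 ≤ t → ∀ φ : ℝ → ℝ, Continuous φ → ∀ R : ℝ, (∀ X, R < |X| → φ X = 0) →
    ∫ X, φ X ∂(ν t) = (∫ X, φ X * survival A 0 t X ∂h0) +
      ∫ s in (0:ℝ)..t, gain G ν (fun X => φ X * survival A s t X) s

lemma continuous_gain_survival (hν : VagueCurve ν) (hG : AdmissibleRate G c)
    (hA : Continuous fun q : ℝ × ℝ => A q.1 q.2) {φ : ℝ → ℝ} (hφ : Continuous φ) {R : ℝ}
    (hR : ∀ X, R < |X| → φ X = 0) :
    Continuous fun q : ℝ × ℝ => gain G ν (fun X => φ X * survival A q.1 q.2 X) q.1 :=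
  continuous_gain (P := ℝ × ℝ) (ψ := fun q X => φ X * survival A q.1 q.2 X) hν hG
    ((hφ.comp continuous_snd).mul ((continuous_survival hA).comp
      (by fun_prop : Continuous fun q : (ℝ × ℝ) × ℝ => (q.1.1, q.1.2, q.2))))
    continuous_fst (fun q X hX => by rw [hR X hX, zero_mul])

/-- The mild formulation restarted at time `t`. -/
lemma MildIdentity.restart (hm : MildIdentity G A h0 ν) (hν : VagueCurve ν)
    (hG : AdmissibleRate G c) (hA : Continuous fun q : ℝ × ℝ => A q.1 q.2) {φ : ℝ → ℝ}
    (hφ : Continuous φ) {R : ℝ} (hR : ∀ X, R < |X| → φ X = 0) {t τ : ℝ} (ht : 0 ≤ t)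
    (hτ : t ≤ τ) :
    ∫ X, φ X ∂(ν τ) = (∫ X, φ X * survival A t τ X ∂(ν t)) +
      ∫ s in t..τ, gain G ν (fun X => φ X * survival A s τ X) s := by
  have hs : Continuous fun X => survival A t τ X :=
    (continuous_survival hA).comp (by fun_prop : Continuous fun X : ℝ => (t, τ, X))
  have hw : Continuous fun s => gain G ν (fun X => φ X * survival A s τ X) s :=
    (continuous_gain_survival hν hG hA hφ hR).comp (by fun_prop : Continuous fun s : ℝ => (s, τ))
  rw [hm τ (ht.trans hτ) φ hφ R hR, hm t ht _ (hφ.fun_mul hs) R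
    (fun X hX => by rw [hR X hX, zero_mul]),
    ← intervalIntegral.integral_add_adjacent_intervals (hw.intervalIntegrable 0 t)
      (hw.intervalIntegrable t τ)]
  simp only [mul_assoc, survival_mul hA]
  ring

/-- Differential inequality behind the mild formulation, integrated by Grönwall's lemma. -/
lemma MildIdentity.integral_le (hν : VagueCurve ν) (hG : AdmissibleRate G c)
    (hm : MildIdentity G (fun X t => loss G ν X t - b) h0 ν) {φ : ℝ → ℝ}
    (hφ : Continuous φ) (hanti : AntitoneOn φ (Ici 0)) {R : ℝ}
    (hR : ∀ X, R < |X| → φ X = 0) {t : ℝ} (ht : 0 ≤ t) :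
    ∫ X, φ X ∂(ν t) ≤ exp (b * t) * ∫ X, φ X ∂h0 := by
  have := hν.locFin
  set A : ℝ → ℝ → ℝ := fun X t => loss G ν X t - b with hAdef
  have hA : Continuous fun q : ℝ × ℝ => A q.1 q.2 := (continuous_loss hν hG).sub continuous_const
  have hS := continuous_survival hA
  have hinit : ∫ X, φ X ∂(ν 0) = ∫ X, φ X ∂h0 := by
    rw [hm 0 le_rfl φ hφ R hR]
    simp [survival_self]
  have hcont : Continuous fun s => ∫ X, φ X ∂(ν s) :=
    hν.cont φ hφ (hasCompactSupport_of_abs hR)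
  have hφi : ∀ s, ∀ f : ℝ → ℝ, Continuous f → Integrable (fun X => φ X * f X) (ν s) :=
    fun s f hf => (hφ.fun_mul hf).integrable_of_hasCompactSupport
      (hasCompactSupport_of_abs (R := R) fun X hX => by rw [hR X hX, zero_mul])
  set B : ℝ → ℝ → ℝ → ℝ := fun x δ X =>
    ∫ u in (0:ℝ)..1, A X (x + δ * u) * survival A x (x + δ * u) X with hB
  have hBc : ∀ x, Continuous fun q : ℝ × ℝ => B x q.1 q.2 := fun x => by
    refine intervalIntegral.continuous_parametric_intervalIntegral_of_continuous'
      (f := fun (q : ℝ × ℝ) u => A q.2 (x + q.1 * u) * survival A x (x + q.1 * u) q.2) ?_ 0 1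
    exact (hA.comp (by fun_prop : Continuous fun p : (ℝ × ℝ) × ℝ =>
      (p.1.2, x + p.1.1 * p.2))).mul (hS.comp (by fun_prop : Continuous fun p : (ℝ × ℝ) × ℝ =>
      (x, x + p.1.1 * p.2, p.1.2)))
  set w : ℝ → ℝ → ℝ := fun s τ => gain G ν (fun X => φ X * survival A s τ X) s with hw
  have hwc : Continuous fun q : ℝ × ℝ => w q.1 q.2 := continuous_gain_survival hν hG hA hφ hR
  set q : ℝ → ℝ → ℝ := fun x δ =>
    (∫ u in (0:ℝ)..1, w (x + δ * u) (x + δ)) - ∫ X, φ X * B x δ X ∂(ν x) with hq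
  have hqc : ∀ x, Continuous (q x) := fun x => by
    refine Continuous.sub ?_ ?_
    · exact intervalIntegral.continuous_parametric_intervalIntegral_of_continuous'
        (f := fun δ u => w (x + δ * u) (x + δ))
        (hwc.comp (by fun_prop : Continuous fun p : ℝ × ℝ => (x + p.1 * p.2, x + p.1))) 0 1
    · exact hν.continuous_integral (f := fun δ X => φ X * B x δ X) (σ := fun _ => x)
        ((hφ.comp continuous_snd).mul (hBc x)) continuous_const
        fun _ => ⟨R, Eventually.of_forall fun δ X hX => by rw [hR X hX, zero_mul]⟩
  have hincr : ∀ x, 0 ≤ x → ∀ δ, 0 ≤ δ →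
      ∫ X, φ X ∂(ν (x + δ)) = ∫ X, φ X ∂(ν x) + δ * q x δ := by
    intro x hx δ hδ
    rw [hm.restart hν hG hA hφ hR hx (le_add_of_nonneg_right hδ)]
    have h1 : ∀ X, φ X * survival A x (x + δ) X = φ X * 1 - δ * (φ X * B x δ X) := fun X => by
      have := one_sub_survival hA x δ X
      change _ = δ * B x δ X at this
      linear_combination -φ X * this
    have h2 : ∫ s in x..(x + δ), w s (x + δ) = δ * ∫ u in (0:ℝ)..1, w (x + δ * u) (x + δ) := by
      rw [intervalIntegral.mul_integral_comp_add_mul (f := fun s => w s (x + δ))]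
      simp
    have hBx : Continuous (B x δ) := (hBc x).comp (by fun_prop : Continuous fun X : ℝ => (δ, X))
    change _ + ∫ s in x..(x + δ), w s (x + δ) = _
    simp_rw [h1]
    rw [h2, integral_sub (hφi x _ continuous_const) ((hφi x _ hBx).const_mul δ),
      integral_const_mul]
    simp only [mul_one, hq]
    ring
  have hq0 : ∀ x, q x 0 ≤ b * ∫ X, φ X ∂(ν x) + 0 := by
    intro x
    have hlc : Continuous fun X => loss G ν X x :=
      (continuous_loss hν hG).comp (by fun_prop : Continuous fun X : ℝ => (X, x))
    have h1 := gain_le_integral_loss hν hG hφ hanti hR x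
    have h2 : ∫ X, φ X * B x 0 X ∂(ν x) =
        ∫ X, φ X * loss G ν X x ∂(ν x) - (∫ X, φ X ∂(ν x)) * b := by
      rw [← integral_mul_const, ← integral_sub (hφi x _ hlc) (hφi x _ continuous_const)]
      simp [hB, hAdef, survival_self, mul_sub]
    have h3 : q x 0 = gain G ν φ x - ∫ X, φ X * B x 0 X ∂(ν x) := by
      simp [hq, hw, survival_self]
    rw [h3, h2]
    linarith
  have key := le_gronwallBound_of_liminf_deriv_right_le (f := fun s => ∫ X, φ X ∂(ν s))
    (f' := fun x => q x 0) (a := 0) (b := t) (ε := 0) (K := b) hcont.continuousOn ?_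
    hinit.le (fun x _ => hq0 x) t ⟨ht, le_rfl⟩
  · rwa [gronwallBound_ε0, sub_zero, mul_comm] at key
  · intro x hx r hr
    refine Eventually.frequently ?_
    have hlim : Tendsto (fun z => q x (z - x)) (𝓝[>] x) (𝓝 (q x 0)) := by
      have := ((hqc x).comp (continuous_sub_right x)).tendsto x
      simp only [Function.comp, sub_self] at this
      exact this.mono_left nhdsWithin_le_nhds
    filter_upwards [hlim.eventually_lt_const hr, self_mem_nhdsWithin] with z hz hxz
    have hpos : 0 < z - x := sub_pos.2 hxz
    have := hincr x hx.1 (z - x) hpos.le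
    rw [add_sub_cancel] at this
    simp only [this, add_sub_cancel_left]
    rwa [inv_mul_cancel_left₀ hpos.ne']

end Gronwall

section MemX

variable {ρ : ℝ} {μ : Measure ℝ}

lemma MemX.isLocallyFiniteMeasure (hμ : MemX ρ μ) : IsLocallyFiniteMeasure μ := by
  refine ⟨fun x => ⟨Iio (|x| + 1), Iio_mem_nhds (by linarith [le_abs_self x]), ?_⟩⟩
  obtain ⟨h0, M, hM⟩ := hμ
  have hsub : Iio (|x| + 1) ⊆ Iio 0 ∪ Icc 0 (|x| + 1) := fun y hy => by
    rcases lt_or_ge y 0 with h | h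
    · exact Or.inl h
    · exact Or.inr ⟨h, le_of_lt hy⟩
  calc μ (Iio (|x| + 1)) ≤ μ (Iio 0) + μ (Icc 0 (|x| + 1)) :=
        (measure_mono hsub).trans (measure_union_le _ _)
    _ < ⊤ := by
        rw [h0, zero_add]
        exact (hM _ (by positivity)).trans_lt ENNReal.ofReal_lt_top

lemma measure_Icc_le_integral_plateau [IsLocallyFiniteMeasure μ] {R ε : ℝ} (hε : 0 < ε) :
    μ (Icc 0 R) ≤ ENNReal.ofReal (∫ X, plateau R ε X ∂μ) := by
  rw [ofReal_integral_eq_lintegral_ofReal ((continuous_plateau R ε).integrable_of_hasCompactSupport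
    (hasCompactSupport_plateau hε)) (Eventually.of_forall fun _ => plateau_nonneg _ _ _),
    ← lintegral_indicator_one measurableSet_Icc]
  refine lintegral_mono fun X => ?_
  by_cases hY : X ∈ Icc 0 R
  swap
  · simp [hY]
  rw [indicator_of_mem hY, plateau_eq_one hε (by rw [abs_of_nonneg hY.1]; exact hY.2)]
  simp

lemma integral_plateau_le [IsLocallyFiniteMeasure μ] (h0 : μ (Iio 0) = 0) {R ε : ℝ} (hε : 0 < ε) :
    ENNReal.ofReal (∫ X, plateau R ε X ∂μ) ≤ μ (Icc 0 (R + ε)) := by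
  rw [ofReal_integral_eq_lintegral_ofReal ((continuous_plateau R ε).integrable_of_hasCompactSupport
    (hasCompactSupport_plateau hε)) (Eventually.of_forall fun _ => plateau_nonneg _ _ _),
    ← lintegral_indicator_one measurableSet_Icc]
  have hae : ∀ᵐ X ∂μ, 0 ≤ X := by
    rw [ae_iff]
    simpa only [not_le] using! h0
  refine lintegral_mono_ae (hae.mono fun X hX => ?_)
  by_cases h : X ≤ R + ε
  · rw [indicator_of_mem (show X ∈ Icc 0 (R + ε) from ⟨hX, h⟩)]
    simpa using plateau_le_one R ε X
  · rw [plateau_eq_zero hε (by rw [abs_of_nonneg hX]; linarith)]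
    simp

end MemX

section Solution

variable {Kl : ℝ → ℝ → ℝ} {β ρ c : ℝ} {h0 : Measure ℝ} {H : ℝ → Measure ℝ}

lemma vagueCurve_of_isMildSolution (hH : ∀ T > (0:ℝ), IsMildSolution Kl β ρ T h0 H) :
    VagueCurve fun s => H (max s 0) := by
  refine ⟨fun s => ?_, fun φ hφ hs => continuous_iff_continuousAt.2 fun s => ?_⟩
  · exact ((hH (|s| + 1) (by positivity)).1 _ ⟨le_max_right _ _,
      max_le (by linarith [le_abs_self s]) (by positivity)⟩).isLocallyFiniteMeasure
  · have hc := (hH (|s| + 1) (by positivity)).2.1 φ hφ hs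
    have hmax : ContinuousOn (fun s : ℝ => max s 0) (Iio (|s| + 1)) := by fun_prop
    exact (hc.comp hmax fun x hx => ⟨le_max_right _ _, max_le (le_of_lt hx) (by positivity)⟩
      ).continuousAt (Iio_mem_nhds (by linarith [le_abs_self s]))

lemma mildIdentity_of_isMildSolution (hG : AdmissibleRate (rate Kl β) c)
    (hH : ∀ T > (0:ℝ), IsMildSolution Kl β ρ T h0 H) :
    MildIdentity (rate Kl β)
      (fun X t => loss (rate Kl β) (fun s => H (max s 0)) X t - β * ρ) h0
      (fun s => H (max s 0)) := by
  intro t ht φ hφ R hR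
  have hν := vagueCurve_of_isMildSolution hH
  set ν : ℝ → Measure ℝ := fun s => H (max s 0) with hνdef
  have hνs : ∀ s, 0 ≤ s → ν s = H s := fun s hs => by simp [hνdef, hs]
  set A : ℝ → ℝ → ℝ := fun X t => loss (rate Kl β) ν X t - β * ρ with hAdef
  have hA : Continuous fun q : ℝ × ℝ => A q.1 q.2 := (continuous_loss hν hG).sub continuous_const
  have hsurv : ∀ s, 0 ≤ s → s ≤ t → ∀ X,
      exp (-(∫ ξ in s..t, Acal Kl β ρ H X ξ)) = survival A s t X := by
    intro s hs hst X
    unfold survival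
    congr 2
    refine intervalIntegral.integral_congr fun ξ hξ => ?_
    rw [uIcc_of_le hst] at hξ
    change Acal Kl β ρ H X ξ = Acal Kl β ρ ν X ξ
    simp only [Acal, hνs ξ (hs.trans hξ.1)]
  rw [hνs t ht, (hH (t + 1) (by linarith)).2.2 t ⟨ht, by linarith⟩ φ hφ
    (hasCompactSupport_of_abs hR)]
  congr 1
  · simp only [hsurv 0 le_rfl ht]
  · refine intervalIntegral.integral_congr fun s hs => ?_
    rw [uIcc_of_le ht] at hs
    simp only [hsurv s hs.1 hs.2]
    have hSc : Continuous fun X => survival A s t X :=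
      (continuous_survival hA).comp (by fun_prop : Continuous fun X : ℝ => (s, t, X))
    rw [← integral_Qcal hν hG (hφ.fun_mul hSc) (R := R) (fun X hX => by rw [hR X hX, zero_mul]) s]
    simp only [Qcal, hνs s hs.1]

/-- Growth of the mass in `[0, R]` in the moving frame. -/
lemma measure_Icc_le_of_isMildSolution (hρ : ρ < 1) (hG : AdmissibleRate (rate Kl β) c)
    (hh0 : MemX ρ h0)
    (hupper : ∀ R > (0:ℝ), h0 (Icc 0 R) ≤ ENNReal.ofReal (R ^ (1 - ρ)))
    (hH : ∀ T > (0:ℝ), IsMildSolution Kl β ρ T h0 H) {t R : ℝ} (ht : 0 ≤ t) (hR : 0 < R) :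
    H t (Icc 0 R) ≤ ENNReal.ofReal (exp (β * ρ * t) * R ^ (1 - ρ)) := by
  have hν := vagueCurve_of_isMildSolution hH
  have hm := mildIdentity_of_isMildSolution hG hH
  have := hh0.isLocallyFiniteMeasure
  have hbound : ∀ ε > (0:ℝ),
      H t (Icc 0 R) ≤ ENNReal.ofReal (exp (β * ρ * t) * (R + ε) ^ (1 - ρ)) := by
    intro ε hε
    have hle := MildIdentity.integral_le hν hG hm (continuous_plateau R ε)
      (fun x hx y _ hxy => plateau_antitoneOn hε hx hxy) (R := R + ε)
      (fun X hX => plateau_eq_zero hε hX.le) ht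
    simp only [max_eq_left ht] at hle
    have : IsLocallyFiniteMeasure (H t) := by simpa only [max_eq_left ht] using hν.locFin t
    calc H t (Icc 0 R) ≤ ENNReal.ofReal (∫ X, plateau R ε X ∂(H t)) :=
          measure_Icc_le_integral_plateau hε
      _ ≤ ENNReal.ofReal (exp (β * ρ * t)) * ENNReal.ofReal (∫ X, plateau R ε X ∂h0) := by
          rw [← ENNReal.ofReal_mul (exp_pos _).le]
          exact ENNReal.ofReal_le_ofReal hle
      _ ≤ ENNReal.ofReal (exp (β * ρ * t)) * ENNReal.ofReal ((R + ε) ^ (1 - ρ)) := by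
          refine mul_le_mul_right ?_ _
          exact (integral_plateau_le hh0.1 hε).trans (hupper (R + ε) (by positivity))
      _ = _ := (ENNReal.ofReal_mul (exp_pos _).le).symm
  have hc : Continuous fun ε : ℝ =>
      ENNReal.ofReal (exp (β * ρ * t) * (R + ε) ^ (1 - ρ)) :=
    ENNReal.continuous_ofReal.comp (continuous_const.mul
      ((by fun_prop : Continuous fun ε : ℝ => R + ε).rpow_const
        fun _ => Or.inr (by linarith)))
  have hlim := (hc.tendsto 0).mono_left (nhdsWithin_le_nhds (s := Ioi 0))
  rw [add_zero] at hlim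
  exact ge_of_tendsto hlim (eventually_mem_nhdsWithin.mono hbound)

end Solution

/-- Invariance of the upper bound `∫_{[0,R]} dh ≤ R^{1-ρ}` under the regularized evolution:
if `h₀` satisfies it, so does `h(·,t) = S_λ(t)h₀` for all `t ≥ 0`. -/
theorem invariance_of_upper_bound
    (γ C ρ β lam : ℝ) (K : ℝ → ℝ → ℝ) (ζ : ℝ → ℝ)
    (hγ : γ ∈ Ico (0:ℝ) 1) (hC : 0 < C) (hK : KernelHyp K γ C) (hζ : CutoffHyp ζ)
    (hρ : ρ ∈ Ioo γ 1) (hβ : β = 1 / (ρ - γ)) (hlam : lam ∈ Ioo (0:ℝ) (1/2))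
    (h0 : Measure ℝ) (hh0 : MemX ρ h0)
    (hupper : ∀ R > (0:ℝ), h0 (Icc 0 R) ≤ ENNReal.ofReal (R ^ (1 - ρ)))
    (H : ℝ → Measure ℝ)
    (hH : ∀ T > (0:ℝ), IsMildSolution (Kreg K ζ lam) β ρ T h0 H) :
    ∀ t ≥ (0:ℝ), ∀ R > (0:ℝ),
      (Smap β t (H t)) (Icc 0 R) ≤ ENNReal.ofReal (R ^ (1 - ρ)) := by
  intro t ht R hR
  have hG := admissibleRate_Kreg hK hζ hlam.1 β
  have he := exp_pos (β * t)
  have hpre : (fun X => X * exp (-(β * t))) ⁻¹' Icc 0 R = Icc 0 (R * exp (β * t)) := by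
    ext X
    rw [mem_preimage, mem_Icc, mem_Icc, exp_neg, ← div_eq_mul_inv, div_le_iff₀ he,
      le_div_iff₀ he, zero_mul]
  have hle := measure_Icc_le_of_isMildSolution hρ.2 hG hh0 hupper hH ht (mul_pos hR he)
  have hexp : exp (-(β * t)) * (exp (β * ρ * t) * (R * exp (β * t)) ^ (1 - ρ)) = R ^ (1 - ρ) := by
    have hsum : exp (-(β * t)) * (exp (β * ρ * t) * exp (β * t * (1 - ρ))) = 1 := by
      rw [← exp_add, ← exp_add, exp_eq_one_iff]
      ring
    rw [mul_rpow hR.le he.le, ← exp_mul]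
    linear_combination R ^ (1 - ρ) * hsum
  rw [Smap, Measure.smul_apply, Measure.map_apply (by fun_prop) measurableSet_Icc, hpre,
    smul_eq_mul]
  calc _ ≤ _ := mul_le_mul_right hle _
    _ = _ := by rw [← ENNReal.ofReal_mul (exp_pos _).le, hexp]

end Smol
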